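/- arXiv:1604.05695 — 2 statements merged into one kernel-verified Lean document; each statement's English description precedes it below -/
import Mathlib

section
/- Let G be a gyrogroup. The radical rad(G) = {a∈G : L_a ∈ L(G)′} is a normal subgroup of G contained in the left nucleus N_l(G): rad(G) ⊆ N_l(G), rad(G) forms a group under ⊕, and rad(G) is a normal subgyrogroup of G (i.e., the kernel of some gyrogroup homomorphism from G). -/
universe u v

/-- A gyrogroup: a groupoid `(G, +)` with a left identity `0`, left inverses `-a`,
gyroautomorphisms `gyr a b` (automorphisms of `(G, +)`) satisfying the left
gyroassociative law, and the left loop property. -/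
class Gyrogroup (G : Type u) extends Add G, Zero G, Neg G where
  /-- (G1) left identity -/
  zero_add' : ∀ a : G, 0 + a = a
  /-- (G2) left inverse -/
  neg_add' : ∀ a : G, -a + a = 0
  /-- (G3) the gyroautomorphisms, as bijections of `G` -/
  gyr : G → G → G ≃ G
  /-- (G3) each `gyr a b` preserves the operation, i.e. is an automorphism -/
  gyr_add' : ∀ a b x y : G, gyr a b (x + y) = gyr a b x + gyr a b y
  /-- (G3) left gyroassociative law -/
  add_gyr_assoc' : ∀ a b c : G, a + (b + c) = (a + b) + gyr a b c
  /-- (G4) left loop property -/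
  left_loop' : ∀ a b : G, gyr (a + b) b = gyr a b

open Gyrogroup

variable {G : Type u}

/-- A subgyrogroup: a nonempty subset closed under the operation and inverses. -/
structure IsSubgyrogroup [Gyrogroup G] (H : Set G) : Prop where
  nonempty : H.Nonempty
  add_mem : ∀ ⦃a : G⦄, a ∈ H → ∀ ⦃b : G⦄, b ∈ H → a + b ∈ H
  neg_mem : ∀ ⦃a : G⦄, a ∈ H → -a ∈ H

/-- A gyrogroup homomorphism: a map preserving the operation. -/
def IsGyroHom [Gyrogroup G] {A : Type v} [Gyrogroup A] (φ : G → A) : Prop :=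
  ∀ x y : G, φ (x + y) = φ x + φ y

/-- The kernel of a map into a gyrogroup. -/
def gyroKer [Gyrogroup G] {A : Type v} [Gyrogroup A] (φ : G → A) : Set G :=
  {x : G | φ x = 0}

/-- A normal subgyrogroup: the kernel of some gyrogroup homomorphism from `G`. -/
def IsNormalSubgyrogroup [Gyrogroup G] (N : Set G) : Prop :=
  IsSubgyrogroup N ∧ ∃ (A : Type u) (instA : Gyrogroup A) (φ : G → A),
    @IsGyroHom G _ A instA φ ∧ N = @gyroKer G _ A instA φ

/-- The gyrocommutator `[a, b] = -(a + b) + gyr a b (b + a)`. -/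
def gyroCommutator [Gyrogroup G] (a b : G) : G :=
  -(a + b) + gyr a b (b + a)

/-- The set of all gyrocommutators of `G`. -/
def gyroCommutatorSet (G : Type u) [Gyrogroup G] : Set G :=
  {x : G | ∃ a b : G, x = gyroCommutator a b}

/-- `K` is the commutator subgyrogroup `G'` of `G`: the smallest subgyrogroup
containing all commutators. -/
def IsCommutatorSubgyrogroup [Gyrogroup G] (K : Set G) : Prop :=
  IsSubgyrogroup K ∧ gyroCommutatorSet G ⊆ K ∧
    ∀ H : Set G, IsSubgyrogroup H → gyroCommutatorSet G ⊆ H → K ⊆ H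

/-- `K` is the normal closure `⟨⟨A⟩⟩` of `A`: the smallest normal subgyrogroup
containing `A`. -/
def IsGyroNormalClosure [Gyrogroup G] (A K : Set G) : Prop :=
  IsNormalSubgyrogroup K ∧ A ⊆ K ∧
    ∀ N : Set G, IsNormalSubgyrogroup N → A ⊆ N → K ⊆ N

/-- The left coset `a ⊕ H`. -/
def lcoset [Gyrogroup G] (a : G) (H : Set G) : Set G := (a + ·) '' H

/-- The right coset `H ⊕ a`. -/
def rcoset [Gyrogroup G] (H : Set G) (a : G) : Set G := (· + a) '' H

/-- A gyrogroup is gyrocommutative if `a + b = gyr a b (b + a)` for all `a, b`. -/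
def IsGyrocommutative (G : Type u) [Gyrogroup G] : Prop :=
  ∀ a b : G, a + b = gyr a b (b + a)

/-- An L-subgyrogroup: a subgyrogroup with `gyr a h (H) = H` for all `a ∈ G`, `h ∈ H`. -/
def IsLSubgyrogroup [Gyrogroup G] (H : Set G) : Prop :=
  IsSubgyrogroup H ∧ ∀ a : G, ∀ h ∈ H, ⇑(gyr a h) '' H = H

/-- A subgroup of a gyrogroup: a subgyrogroup that forms a group under the gyrogroup
operation (equivalently, on which the operation is associative; together with the
closure properties and the identity and inverses inherited from `G`, this makes it
a group). -/
def IsSubgroupOfGyrogroup [Gyrogroup G] (H : Set G) : Prop :=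
  IsSubgyrogroup H ∧ ∀ a ∈ H, ∀ b ∈ H, ∀ c ∈ H, a + (b + c) = (a + b) + c

/-- The left nucleus of `G`. -/
def leftNucleus (G : Type u) [Gyrogroup G] : Set G :=
  {a : G | ∀ b c : G, a + (b + c) = (a + b) + c}

/-- The middle nucleus of `G`. -/
def middleNucleus (G : Type u) [Gyrogroup G] : Set G :=
  {b : G | ∀ a c : G, a + (b + c) = (a + b) + c}

/-- The right nucleus of `G`. -/
def rightNucleus (G : Type u) [Gyrogroup G] : Set G :=
  {c : G | ∀ a b : G, a + (b + c) = (a + b) + c}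

/-- `L(G)`: the set of left gyrotranslations of `G`, viewed as permutations of `G`.
A permutation `σ` is a left gyrotranslation when `σ x = a + x` for some fixed `a`. -/
def LSet (G : Type u) [Gyrogroup G] : Set (Equiv.Perm G) :=
  {σ : Equiv.Perm G | ∃ a : G, ∀ x : G, σ x = a + x}

/-- `L(H)` for a subset `H ⊆ G`: the left gyrotranslations by elements of `H`. -/
def LSetOf [Gyrogroup G] (H : Set G) : Set (Equiv.Perm G) :=
  {σ : Equiv.Perm G | ∃ a ∈ H, ∀ x : G, σ x = a + x}

/-- The left multiplication group `LMlt(G)`: the subgroup of `Sym(G)` generated by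
the left gyrotranslations. -/
def LMlt (G : Type u) [Gyrogroup G] : Subgroup (Equiv.Perm G) :=
  Subgroup.closure (LSet G)

/-- `L(G)'`: the set of products `L_{a₁} ∘ ⋯ ∘ L_{aₙ}` of left gyrotranslations whose
reversed product `L_{aₙ} ∘ ⋯ ∘ L_{a₁}` is the identity. -/
def LPrime (G : Type u) [Gyrogroup G] : Set (Equiv.Perm G) :=
  {σ : Equiv.Perm G | ∃ l : List (Equiv.Perm G),
    (∀ τ ∈ l, τ ∈ LSet G) ∧ σ = l.prod ∧ l.reverse.prod = 1}

/-- `L(G)^# = ⋂_{a ∈ G} L_a ∘ L(G)`. -/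
def LSharp (G : Type u) [Gyrogroup G] : Set (Equiv.Perm G) :=
  {σ : Equiv.Perm G | ∀ ρ ∈ LSet G, ∃ τ ∈ LSet G, σ = ρ * τ}

/-- The radical of `G`: elements whose left gyrotranslation lies in `L(G)'`. -/
def gyroRadical (G : Type u) [Gyrogroup G] : Set G :=
  {a : G | ∃ σ ∈ LPrime G, ∀ x : G, σ x = a + x}

/-- `X` is a normal subgroup of the subgroup `Γ` (as a subset of the ambient group). -/
def IsNormalSubgroupIn {M : Type v} [Group M] (Γ : Subgroup M) (X : Set M) : Prop :=
  X ⊆ (Γ : Set M) ∧ (1 : M) ∈ X ∧ (∀ σ ∈ X, σ⁻¹ ∈ X) ∧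
    (∀ σ ∈ X, ∀ τ ∈ X, σ * τ ∈ X) ∧ ∀ γ ∈ Γ, ∀ σ ∈ X, γ * σ * γ⁻¹ ∈ X

/-- The coaddition `a ⊞ b = a + gyr a (-b) b`. -/
def gyroCoadd [Gyrogroup G] (a b : G) : G := a + gyr a (-b) b

/-- Natural-number multiples: `0 • a = 0`, `(m+1) • a = a + m • a`. -/
def gyroNsmul [Gyrogroup G] : ℕ → G → G
  | 0, _ => 0
  | n + 1, a => a + gyroNsmul n a

/-- The index `[G : H]`: the number of left cosets of `H` in `G`. -/
noncomputable def gyroIndex [Gyrogroup G] (H : Set G) : ℕ :=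
  Set.ncard {S : Set G | ∃ a : G, S = lcoset a H}

namespace Gyrogroup

section Basic

variable [Gyrogroup G]

theorem add_left_injective' (a : G) : Function.Injective (a + ·) := fun x y h => by
  have h' : -a + (a + x) = -a + (a + y) := congrArg (-a + ·) h
  simp only [add_gyr_assoc', neg_add', zero_add'] at h'
  exact (gyr (-a) a).injective h'

theorem gyr_zero_left (a c : G) : gyr 0 a c = c := by
  apply add_left_injective' a
  simpa only [zero_add'] using (add_gyr_assoc' 0 a c).symm

theorem neg_add_cancel_left' (a b : G) : -a + (a + b) = b := by
  rw [add_gyr_assoc', ← left_loop', neg_add', zero_add', gyr_zero_left]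

theorem add_zero' (a : G) : a + 0 = a := by
  apply add_left_injective' (-a)
  simp only [neg_add_cancel_left', neg_add']

theorem add_neg' (a : G) : a + -a = 0 := by
  apply add_left_injective' (-a)
  simp only [neg_add_cancel_left', add_zero']

theorem add_neg_cancel_left' (a b : G) : a + (-a + b) = b := by
  apply add_left_injective' (-a)
  simp only [neg_add_cancel_left']

/-- The gyrator identity. -/
theorem gyr_apply (a b c : G) : gyr a b c = -(a + b) + (a + (b + c)) := by
  rw [add_gyr_assoc' a b c, neg_add_cancel_left']

/-- The left Bol identity. -/
theorem bol (a b c : G) : a + (b + (a + c)) = (a + (b + a)) + c := by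
  have h := left_loop' (-b) (b + a)
  have h' := congrArg (fun e : G ≃ G => e (-(b + a) + (b + (a + c)))) h
  simp only [gyr_apply, neg_add_cancel_left', add_neg_cancel_left'] at h'
  nth_rw 2 [← h']
  rw [add_neg_cancel_left']

end Basic

section Quotient

variable [Gyrogroup G] (r : AddCon G)

instance : Neg r.Quotient where
  neg := Quotient.map (fun x : G => -x) fun a b (h : r a b) => by
    have := r.add (r.refl (-a)) (r.add (r.symm h) (r.refl (-b)))
    rw [add_neg', add_zero', neg_add_cancel_left'] at this
    exact this

theorem quotient_neg_add_cancel_left (a b : r.Quotient) : -a + (a + b) = b := by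
  induction a, b using AddCon.induction_on₂ with
  | H a b => exact congrArg ((↑) : G → r.Quotient) (neg_add_cancel_left' a b)

theorem quotient_add_neg_cancel_left (a b : r.Quotient) : a + (-a + b) = b := by
  induction a, b using AddCon.induction_on₂ with
  | H a b => exact congrArg ((↑) : G → r.Quotient) (add_neg_cancel_left' a b)

/-- The quotient of a gyrogroup by a congruence is a gyrogroup. -/
@[reducible]
def quotient : Gyrogroup r.Quotient where
  zero := ((0 : G) : r.Quotient)
  zero_add' := by
    rintro ⟨a⟩
    exact congrArg ((↑) : G → r.Quotient) (zero_add' a)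
  neg_add' := by
    rintro ⟨a⟩
    exact congrArg ((↑) : G → r.Quotient) (neg_add' a)
  gyr a b :=
    { toFun := fun c => -(a + b) + (a + (b + c))
      invFun := fun c => -b + (-a + ((a + b) + c))
      left_inv := fun c => by
        simp only [quotient_neg_add_cancel_left, quotient_add_neg_cancel_left]
      right_inv := fun c => by
        simp only [quotient_neg_add_cancel_left, quotient_add_neg_cancel_left] }
  gyr_add' := by
    rintro ⟨a⟩ ⟨b⟩ ⟨x⟩ ⟨y⟩
    have h := gyr_add' a b x y
    simp only [gyr_apply] at h
    exact congrArg ((↑) : G → r.Quotient) h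
  add_gyr_assoc' a b c := (quotient_add_neg_cancel_left r (a + b) (a + (b + c))).symm
  left_loop' := by
    rintro ⟨a⟩ ⟨b⟩
    ext ⟨c⟩
    have h := congrArg (fun e : G ≃ G => e c) (left_loop' a b)
    simp only [gyr_apply] at h
    exact congrArg ((↑) : G → r.Quotient) h

end Quotient

section LeftTranslations

variable [Gyrogroup G]

/-- The left gyrotranslation by `a`, as a permutation. -/
def leftEquiv (a : G) : Equiv.Perm G where
  toFun x := a + x
  invFun x := -a + x
  left_inv := neg_add_cancel_left' a
  right_inv := add_neg_cancel_left' a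

@[simp]
theorem leftEquiv_apply (a x : G) : leftEquiv a x = a + x := rfl

theorem leftEquiv_mem (a : G) : leftEquiv a ∈ LSet G := ⟨a, fun _ => rfl⟩

theorem one_mem_lSet : (1 : Equiv.Perm G) ∈ LSet G := ⟨0, fun x => (zero_add' x).symm⟩

theorem eq_leftEquiv_of_mem_lSet {σ : Equiv.Perm G} (hσ : σ ∈ LSet G) : σ = leftEquiv (σ 0) := by
  obtain ⟨a, ha⟩ := hσ
  ext x
  rw [leftEquiv_apply, ha, ha, add_zero']

theorem forall_apply_eq_add_iff {σ : Equiv.Perm G} (hσ : σ ∈ LSet G) {a : G} :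
    (∀ x, σ x = a + x) ↔ σ 0 = a := by
  refine ⟨fun h => by rw [h, add_zero'], ?_⟩
  rintro rfl x
  exact congrArg (fun e : Equiv.Perm G => e x) (eq_leftEquiv_of_mem_lSet hσ)

theorem inv_mem_lSet {σ : Equiv.Perm G} (hσ : σ ∈ LSet G) : σ⁻¹ ∈ LSet G := by
  rw [eq_leftEquiv_of_mem_lSet hσ]
  exact ⟨-σ 0, fun _ => rfl⟩

theorem mul_mul_mem_lSet {σ ρ : Equiv.Perm G} (hσ : σ ∈ LSet G) (hρ : ρ ∈ LSet G) :
    σ * ρ * σ ∈ LSet G := by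
  obtain ⟨a, ha⟩ := hσ
  obtain ⟨b, hb⟩ := hρ
  refine ⟨a + (b + a), fun x => ?_⟩
  simp only [Equiv.Perm.mul_apply, ha, hb, bol]

theorem prod_mul_reverse_prod_mem_lSet {l : List (Equiv.Perm G)} (hl : ∀ τ ∈ l, τ ∈ LSet G)
    {ρ : Equiv.Perm G} (hρ : ρ ∈ LSet G) : l.prod * ρ * l.reverse.prod ∈ LSet G := by
  induction l with
  | nil => simpa using hρ
  | cons σ l ih =>
    have := mul_mul_mem_lSet (hl σ (by simp)) (ih fun τ hτ => hl τ (by simp [hτ]))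
    simpa [mul_assoc] using this

theorem mul_mem_lSet {σ ρ : Equiv.Perm G} (hσ : σ ∈ LPrime G) (hρ : ρ ∈ LSet G) :
    σ * ρ ∈ LSet G := by
  obtain ⟨l, hl, rfl, h⟩ := hσ
  simpa [h] using prod_mul_reverse_prod_mem_lSet hl hρ

theorem lPrime_subset_lSet : LPrime G ⊆ LSet G := fun σ hσ => by
  simpa using mul_mem_lSet hσ one_mem_lSet

theorem one_mem_lPrime : (1 : Equiv.Perm G) ∈ LPrime G := ⟨[], by simp⟩

theorem mul_mem_lPrime {σ τ : Equiv.Perm G} (hσ : σ ∈ LPrime G) (hτ : τ ∈ LPrime G) :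
    σ * τ ∈ LPrime G := by
  obtain ⟨l, hl, rfl, h⟩ := hσ
  obtain ⟨m, hm, rfl, h'⟩ := hτ
  refine ⟨l ++ m, fun ρ hρ => ?_, by simp, by simp [h, h']⟩
  exact (List.mem_append.1 hρ).elim (hl ρ) (hm ρ)

theorem inv_mem_lPrime {σ : Equiv.Perm G} (hσ : σ ∈ LPrime G) : σ⁻¹ ∈ LPrime G := by
  obtain ⟨l, hl, rfl, h⟩ := hσ
  refine ⟨(l.map (·⁻¹)).reverse, fun ρ hρ => ?_, List.prod_inv_reverse l, ?_⟩
  · obtain ⟨τ, hτ, rfl⟩ := List.mem_map.1 (List.mem_reverse.1 hρ)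
    exact inv_mem_lSet (hl τ hτ)
  · rw [← inv_inj, inv_one, List.prod_inv_reverse]
    simpa [Function.comp_def] using h

theorem conj_mem_lPrime {σ ρ : Equiv.Perm G} (hσ : σ ∈ LPrime G) (hρ : ρ ∈ LSet G) :
    ρ * σ * ρ⁻¹ ∈ LPrime G := by
  obtain ⟨l, hl, rfl, h⟩ := hσ
  refine ⟨ρ :: (l ++ [ρ⁻¹]), fun τ hτ => ?_, by simp [mul_assoc], by simp [h]⟩
  simp only [List.mem_cons, List.mem_append, List.not_mem_nil, or_false] at hτ
  rcases hτ with rfl | hτ | rfl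
  exacts [hρ, hl τ hτ, inv_mem_lSet hρ]

variable (G) in
/-- The congruence on `G` whose classes are the orbits of `L(G)'`. -/
def radicalCon : AddCon G where
  r a b := ∃ σ ∈ LPrime G, σ a = b
  iseqv :=
    { refl := fun _ => ⟨1, one_mem_lPrime, rfl⟩
      symm := by
        rintro a _ ⟨σ, hσ, rfl⟩
        exact ⟨σ⁻¹, inv_mem_lPrime hσ, by simp⟩
      trans := by
        rintro a _ _ ⟨σ, hσ, rfl⟩ ⟨τ, hτ, rfl⟩
        exact ⟨τ * σ, mul_mem_lPrime hτ hσ, rfl⟩ }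
  add' := by
    rintro a _ b _ ⟨σ, hσ, rfl⟩ ⟨τ, hτ, rfl⟩
    refine ⟨σ * (leftEquiv a * τ * (leftEquiv a)⁻¹),
      mul_mem_lPrime hσ (conj_mem_lPrime hτ (leftEquiv_mem a)), ?_⟩
    have h : ∀ x, (σ * leftEquiv a) x = σ a + x :=
      (forall_apply_eq_add_iff (mul_mem_lSet hσ (leftEquiv_mem a))).2
        (by rw [Equiv.Perm.mul_apply, leftEquiv_apply, add_zero'])
    rw [← h, ← leftEquiv_apply a b, ← Equiv.Perm.mul_apply, ← Equiv.Perm.mul_apply]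
    group

end LeftTranslations

end Gyrogroup

/-- the radical `rad(G) = {a : L_a ∈ L(G)'}` is a normal subgroup of `G`
contained in the left nucleus: `rad(G) ⊆ N_l(G)`, `rad(G)` forms a group under the
operation, and `rad(G)` is a normal subgyrogroup of `G`. -/
theorem radical_normal_subgroup_subset_leftNucleus (G : Type u) [Gyrogroup G] :
    gyroRadical G ⊆ leftNucleus G ∧ IsSubgroupOfGyrogroup (gyroRadical G) ∧
      IsNormalSubgyrogroup (gyroRadical G) := by
  have mem_iff (a : G) : a ∈ gyroRadical G ↔ Gyrogroup.radicalCon G 0 a := by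
    refine exists_congr fun σ => and_congr_right fun hσ => ?_
    exact Gyrogroup.forall_apply_eq_add_iff (Gyrogroup.lPrime_subset_lSet hσ)
  have nucleus : gyroRadical G ⊆ leftNucleus G := by
    rintro a ⟨σ, hσ, ha⟩ b c
    obtain ⟨d, hd⟩ := Gyrogroup.mul_mem_lSet hσ (Gyrogroup.leftEquiv_mem b)
    have h0 := hd 0
    have hc := hd c
    simp only [Equiv.Perm.mul_apply, Gyrogroup.leftEquiv_apply, ha, Gyrogroup.add_zero'] at h0 hc
    rw [hc, h0]
  have sub : IsSubgyrogroup (gyroRadical G) := by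
    refine ⟨⟨0, (mem_iff 0).2 (AddCon.refl _ 0)⟩, fun a ha b hb => ?_, fun a ha => ?_⟩
    · rw [mem_iff] at *
      simpa only [zero_add'] using AddCon.add _ ha hb
    · rw [mem_iff] at *
      have := AddCon.add _ (AddCon.refl _ (-a)) (AddCon.symm _ ha)
      rw [Gyrogroup.neg_add', Gyrogroup.add_zero'] at this
      exact this
  refine ⟨nucleus, ⟨sub, fun a ha b _ c _ => nucleus ha b c⟩, sub,
    (Gyrogroup.radicalCon G).Quotient, Gyrogroup.quotient _, (↑), fun _ _ => rfl, ?_⟩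
  ext a
  rw [mem_iff]
  exact ⟨fun h => (AddCon.eq _).2 (AddCon.symm _ h), fun h => AddCon.symm _ ((AddCon.eq _).1 h)⟩
end

section
/- Let G be a finite gyrogroup and H a subgyrogroup of G such that [G : H] = p is the smallest prime dividing |G|. Then H is a normal subgyrogroup of G if and only if there exists y ∈ G∖H such that gyr[a,b](iy⊕H) ⊆ iy⊕H for all a,b∈G and all i ∈ {0,1,…,p−1}. -/
universe u v

open Gyrogroup

variable {G : Type u}

namespace Gyrogroup

section Basic

variable [Gyrogroup G]

theorem add_left_cancel' {a b c : G} (h : a + b = a + c) : b = c := by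
  have h' : -a + (a + b) = -a + (a + c) := by rw [h]
  rw [add_gyr_assoc', add_gyr_assoc', neg_add', zero_add', zero_add'] at h'
  exact (gyr (-a) a).injective h'

theorem neg_zero' : -(0 : G) = 0 := by
  rw [← add_zero' (-(0 : G)), neg_add']

theorem gyr_self (a c : G) : gyr a a c = c := by
  have h := left_loop' 0 a
  rw [zero_add'] at h
  rw [h, gyr_zero_left]

/-- If a left gyrotranslation has a fixed point, then it is trivial. -/
theorem eq_zero_of_add_eq_right {a x : G} (h : a + x = x) : a = 0 := by
  have key : a + (x + -x) = x + -x := by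
    rw [add_gyr_assoc', ← left_loop', h, gyr_self]
  rwa [add_neg', add_zero'] at key

/-- The left Bol identity. -/
theorem left_bol (a b c : G) : b + (a + (b + c)) = (b + (a + b)) + c := by
  have h₁ : gyr b (a + b) (gyr a b c) = c := by
    have h := left_loop' (-a) (a + b)
    rw [neg_add_cancel_left'] at h
    rw [h]
    apply add_left_cancel' (a := -a + (a + b))
    rw [← add_gyr_assoc', ← add_gyr_assoc', neg_add_cancel_left', neg_add_cancel_left']
  rw [add_gyr_assoc' a b c, add_gyr_assoc' b, h₁]

/-- The left gyrotranslation by `a`, as a permutation. -/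
def leftPerm (a : G) : Equiv.Perm G where
  toFun x := a + x
  invFun x := -a + x
  left_inv := neg_add_cancel_left' a
  right_inv := add_neg_cancel_left' a

theorem leftPerm_apply (a x : G) : leftPerm a x = a + x := rfl

/-- Gyrogroups are left power alternative. -/
theorem leftPerm_pow_apply (a : G) (n : ℕ) (x : G) :
    (leftPerm a ^ n) x = gyroNsmul n a + x := by
  induction n using Nat.twoStepInduction generalizing x with
  | zero => simp [gyroNsmul, zero_add']
  | one => simp [gyroNsmul, leftPerm_apply, add_zero']
  | more n ih _ =>
    have hcomm : a + gyroNsmul n a = gyroNsmul n a + a := by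
      rw [← ih a]
      have h := ih 0
      rw [add_zero'] at h
      rw [← h, ← leftPerm_apply, ← Equiv.Perm.mul_apply, ← pow_succ', pow_succ,
        Equiv.Perm.mul_apply, leftPerm_apply, add_zero']
    rw [pow_succ, pow_succ', Equiv.Perm.mul_apply, Equiv.Perm.mul_apply, ih,
      leftPerm_apply, leftPerm_apply, left_bol, gyroNsmul, gyroNsmul, ← hcomm]

theorem gyroNsmul_add (a : G) (m n : ℕ) (x : G) :
    gyroNsmul m a + (gyroNsmul n a + x) = gyroNsmul (m + n) a + x := by
  simp only [← leftPerm_pow_apply, pow_add, Equiv.Perm.mul_apply]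

theorem gyr_gyroNsmul (a : G) (m n : ℕ) (x : G) :
    gyr (gyroNsmul m a) (gyroNsmul n a) x = x := by
  apply add_left_cancel' (a := gyroNsmul m a + gyroNsmul n a)
  rw [← add_gyr_assoc', gyroNsmul_add]
  have h := gyroNsmul_add a m n 0
  rw [add_zero', add_zero'] at h
  rw [h]

/-- Left gyrotranslations are semiregular, so their order divides the order of `G`. -/
theorem leftPerm_pow_card [Finite G] (a : G) : leftPerm a ^ Nat.card G = 1 := by
  have hfree : ∀ x : G, MulAction.stabilizer (Subgroup.zpowers (leftPerm a)) x = ⊥ := by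
    intro x
    rw [eq_bot_iff]
    rintro ⟨σ, hσ⟩ hx
    obtain ⟨n, rfl⟩ := (mem_powers_iff_mem_zpowers.mpr hσ)
    have hfix : (leftPerm a ^ n) x = x := hx
    rw [leftPerm_pow_apply] at hfix
    have h0 := eq_zero_of_add_eq_right hfix
    rw [Subgroup.mem_bot]
    ext z
    change (leftPerm a ^ n) z = z
    rw [leftPerm_pow_apply, h0, zero_add']
  rw [← orderOf_dvd_iff_pow_eq_one, ← Nat.card_zpowers,
    Nat.card_congr (MulAction.selfEquivOrbitsQuotientProd hfree), Nat.card_prod]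
  exact Dvd.intro_left _ rfl

end Basic

section Hom

variable [Gyrogroup G] {A : Type*} [Gyrogroup A] {φ : G → A}

theorem map_zero' (hφ : IsGyroHom φ) : φ 0 = 0 := by
  apply add_left_cancel' (a := φ 0)
  rw [← hφ, zero_add', add_zero']

theorem map_neg' (hφ : IsGyroHom φ) (a : G) : φ (-a) = -φ a := by
  apply add_left_cancel' (a := φ a)
  rw [← hφ, add_neg', add_neg', map_zero' hφ]

theorem map_gyroNsmul (hφ : IsGyroHom φ) (n : ℕ) (a : G) :
    φ (gyroNsmul n a) = gyroNsmul n (φ a) := by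
  induction n with
  | zero => exact map_zero' hφ
  | succ n ih => rw [gyroNsmul, hφ, ih, gyroNsmul]

theorem map_gyr (hφ : IsGyroHom φ) (a b c : G) :
    φ (gyr a b c) = gyr (φ a) (φ b) (φ c) := by
  apply add_left_cancel' (a := φ a + φ b)
  rw [← add_gyr_assoc', ← hφ, ← hφ, ← add_gyr_assoc', hφ, hφ]

theorem mem_lcoset_iff {H : Set G} {a x : G} : x ∈ lcoset a H ↔ -a + x ∈ H := by
  constructor
  · rintro ⟨h, hh, rfl⟩
    simpa only [neg_add_cancel_left'] using hh
  · exact fun h => ⟨_, h, add_neg_cancel_left' a x⟩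

theorem mem_lcoset_gyroKer_iff (hφ : IsGyroHom φ) {a x : G} :
    x ∈ lcoset a (gyroKer φ) ↔ φ a = φ x := by
  rw [mem_lcoset_iff, gyroKer, Set.mem_ofPred_eq, hφ, map_neg' hφ]
  constructor
  · intro h
    rw [← add_neg_cancel_left' (φ a) (φ x), h, add_zero']
  · intro h
    rw [h, neg_add']

end Hom

/-- Every group is a gyrogroup, with trivial gyroautomorphisms. -/
abbrev ofGroup (M : Type u) [Group M] : Gyrogroup M where
  add := (· * ·)
  zero := 1
  neg := (·⁻¹)
  zero_add' := one_mul
  neg_add' := inv_mul_cancel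
  gyr _ _ := Equiv.refl M
  gyr_add' _ _ _ _ := rfl
  add_gyr_assoc' a b c := (mul_assoc a b c).symm
  left_loop' _ _ := rfl

end Gyrogroup

namespace Equiv.Perm

variable {X : Type*} [Finite X] {σ : Equiv.Perm X} {N : ℕ}

/-- If every prime factor of `N` is at least `|X|` and `σ ^ N = 1`, then the orbit of any
non-fixed point of `σ` is the whole of `X`. -/
theorem exists_pow_apply_eq_of_apply_ne (hσ : σ ^ N = 1)
    (hmin : ∀ q : ℕ, q.Prime → q ∣ N → Nat.card X ≤ q) {x : X} (hx : σ x ≠ x) (z : X) :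
    ∃ i < Nat.card X, (σ ^ i) x = z := by
  have hdvd : Function.minimalPeriod σ x ∣ N := by
    apply Function.IsPeriodicPt.minimalPeriod_dvd
    rw [Function.IsPeriodicPt, Function.IsFixedPt, Equiv.Perm.iterate_eq_pow, hσ, one_apply]
  have hne : Function.minimalPeriod σ x ≠ 1 := fun h =>
    hx (Function.minimalPeriod_eq_one_iff_isFixedPt.mp h)
  have hpos : 0 < Function.minimalPeriod σ x :=
    Function.minimalPeriod_pos_of_mem_periodicPts
      (Function.Injective.mem_periodicPts σ.injective x)
  have hle : Nat.card X ≤ Function.minimalPeriod σ x :=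
    (hmin _ (Nat.minFac_prime hne) ((Nat.minFac_dvd _).trans hdvd)).trans
      (Nat.minFac_le hpos)
  have hinj : Function.Injective fun i : Fin (Nat.card X) => (σ ^ (i : ℕ)) x := by
    intro i j hij
    simp only [← Equiv.Perm.iterate_eq_pow] at hij
    exact Fin.ext (Function.iterate_injOn_Iio_minimalPeriod
      (i.2.trans_le hle) (j.2.trans_le hle) hij)
  obtain ⟨i, hi⟩ := ((Nat.bijective_iff_injective_and_card _).mpr
    ⟨hinj, by rw [Nat.card_fin]⟩).2 z
  exact ⟨i, i.2, hi⟩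

theorem eq_one_of_apply_eq (hσ : σ ^ N = 1)
    (hmin : ∀ q : ℕ, q.Prime → q ∣ N → Nat.card X ≤ q) {x : X} (hx : σ x = x) : σ = 1 := by
  ext z
  by_contra hz
  obtain ⟨i, -, hi⟩ := exists_pow_apply_eq_of_apply_ne hσ hmin hz x
  have hfix : (σ ^ i) x = x := by
    rw [← Equiv.Perm.iterate_eq_pow]
    exact Function.iterate_fixed hx i
  exact hz ((σ ^ i).injective (hi.trans hfix.symm) ▸ hx)

end Equiv.Perm

namespace Gyrogroup

section Cosets

variable [Gyrogroup G] {H : Set G} (s : Setoid G)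

theorem card_quotient_eq_gyroIndex (hs : ∀ a x, x ∈ lcoset a H ↔ s a x) :
    Nat.card (Quotient s) = gyroIndex H := by
  have hker : s = Setoid.ker fun a => lcoset a H := by
    ext a b
    change _ ↔ lcoset a H = lcoset b H
    rw [← hs]
    constructor
    · intro h
      ext x
      rw [hs, hs]
      have hab := (hs a b).mp h
      exact ⟨fun hx => s.trans (s.symm hab) hx, fun hx => s.trans hab hx⟩
    · intro h
      rw [h, hs]
  have hset : {S : Set G | ∃ a : G, S = lcoset a H} = Set.range fun a => lcoset a H := by
    ext S
    simp [eq_comm]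
  rw [gyroIndex, hset, ← Nat.card_coe_set_eq, hker]
  exact Nat.card_congr (Setoid.quotientKerEquivRange _)

variable {s} (hadd : ∀ a x z : G, s x z → s (a + x) (a + z))

/-- The permutation of the classes of a left compatible equivalence relation induced by
a left gyrotranslation. -/
def quotientPerm (a : G) : Equiv.Perm (Quotient s) :=
  Quotient.congr (leftPerm a) fun x z => by
    refine ⟨hadd a x z, fun h => ?_⟩
    have h' := hadd (-a) _ _ h
    rwa [leftPerm_apply, leftPerm_apply, neg_add_cancel_left', neg_add_cancel_left'] at h'

theorem quotientPerm_mk (a x : G) :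
    quotientPerm hadd a (Quotient.mk s x) = Quotient.mk s (a + x) := rfl

theorem quotientPerm_pow_mk (a x : G) (n : ℕ) :
    (quotientPerm hadd a ^ n) (Quotient.mk s x) = Quotient.mk s (gyroNsmul n a + x) := by
  rw [← leftPerm_pow_apply]
  induction n with
  | zero => rfl
  | succ n ih => rw [pow_succ', pow_succ', Equiv.Perm.mul_apply, ih]; rfl

theorem quotientPerm_pow_card [Finite G] (a : G) : quotientPerm hadd a ^ Nat.card G = 1 := by
  ext x
  induction x using Quotient.inductionOn with
  | h x => rw [quotientPerm_pow_mk, ← leftPerm_pow_apply, leftPerm_pow_card]; rfl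


variable [Finite G]

/-- If every prime factor of `|G|` is at least `[G : H]`, then the multiples of any element
outside `H` represent all cosets. -/
theorem exists_gyroNsmul_rel (hadd : ∀ a x z : G, s x z → s (a + x) (a + z))
    (hs : ∀ a x, x ∈ lcoset a H ↔ s a x)
    (hmin : ∀ q : ℕ, q.Prime → q ∣ Nat.card G → gyroIndex H ≤ q)
    {y : G} (hy : y ∉ H) (x : G) :
    ∃ i < gyroIndex H, s (gyroNsmul i y) x := by
  rw [← card_quotient_eq_gyroIndex s hs] at hmin ⊢
  have hne : quotientPerm hadd y (Quotient.mk s 0) ≠ Quotient.mk s 0 := by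
    rw [quotientPerm_mk, add_zero']
    intro h
    have hy0 := (hs 0 y).mpr (s.symm (Quotient.exact h))
    rw [mem_lcoset_iff, neg_zero', zero_add'] at hy0
    exact hy hy0
  obtain ⟨i, hi, hix⟩ := Equiv.Perm.exists_pow_apply_eq_of_apply_ne
    (quotientPerm_pow_card hadd y) hmin hne (Quotient.mk s x)
  rw [quotientPerm_pow_mk, add_zero'] at hix
  exact ⟨i, hi, Quotient.exact hix⟩

/-- If every prime factor of `|G|` is at least `[G : H]`, then `H` consists of the elements
acting trivially on its cosets. -/
theorem quotientPerm_eq_one_iff (hs : ∀ a x, x ∈ lcoset a H ↔ s a x)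
    (hmin : ∀ q : ℕ, q.Prime → q ∣ Nat.card G → gyroIndex H ≤ q)
    {a : G} : quotientPerm hadd a = 1 ↔ a ∈ H := by
  have h0 : a ∈ H ↔ quotientPerm hadd a (Quotient.mk s 0) = Quotient.mk s 0 := by
    rw [quotientPerm_mk, add_zero', Quotient.eq, s.comm', ← hs, mem_lcoset_iff, neg_zero',
      zero_add']
  rw [h0]
  constructor
  · intro h
    rw [h, Equiv.Perm.one_apply]
  · intro h
    rw [← card_quotient_eq_gyroIndex s hs] at hmin
    exact Equiv.Perm.eq_one_of_apply_eq (quotientPerm_pow_card hadd a) hmin h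

/-- If every prime factor of `|G|` is at least `[G : H]` and gyrations preserve every coset
of the subgyrogroup `H`, then `H` is normal. -/
theorem isNormalSubgyrogroup_of_gyr_rel (hadd : ∀ a x z : G, s x z → s (a + x) (a + z))
    (hs : ∀ a x, x ∈ lcoset a H ↔ s a x)
    (hmin : ∀ q : ℕ, q.Prime → q ∣ Nat.card G → gyroIndex H ≤ q)
    (hH : IsSubgyrogroup H)
    (hgyr : ∀ a b x : G, s x (gyr a b x)) : IsNormalSubgyrogroup H := by
  refine ⟨hH, Equiv.Perm (Quotient s), ofGroup _, quotientPerm hadd, fun a b => ?_, ?_⟩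
  · ext x
    induction x using Quotient.inductionOn with
    | h x =>
      change Quotient.mk s ((a + b) + x) = Quotient.mk s (a + (b + x))
      rw [add_gyr_assoc']
      exact Quotient.sound (hadd _ _ _ (hgyr a b x))
  · ext a
    exact (quotientPerm_eq_one_iff hadd hs hmin).symm

end Cosets

section GyrInvariant

variable [Gyrogroup G] {H : Set G}

theorem neg_add_add_left (c a x : G) : -(c + a) + (c + x) = gyr c a (-a + x) := by
  apply add_left_cancel' (a := c + a)
  rw [add_neg_cancel_left', ← add_gyr_assoc', add_neg_cancel_left']

/-- The left coset equivalence relation of a gyration-invariant subgyrogroup. -/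
def lcosetSetoid (hH : IsSubgyrogroup H)
    (hinv : ∀ a b : G, ∀ h ∈ H, gyr a b h ∈ H) : Setoid G where
  r a x := -a + x ∈ H
  iseqv := by
    have hsymm : ∀ {a x : G}, -a + x ∈ H → -x + a ∈ H := by
      intro a x h
      have key := neg_add_add_left a (-a + x) 0
      rw [add_neg_cancel_left', add_zero', add_zero'] at key
      rw [key]
      exact hinv _ _ _ (hH.neg_mem h)
    refine ⟨fun a => ?_, hsymm, fun {a x z} hax hxz => ?_⟩
    · obtain ⟨h, hh⟩ := hH.nonempty
      rw [neg_add', ← neg_add' h]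
      exact hH.add_mem (hH.neg_mem hh) hh
    · have key := neg_add_add_left x (-x + a) (-x + z)
      rw [add_neg_cancel_left', add_neg_cancel_left'] at key
      rw [key]
      exact hinv _ _ _ (hH.add_mem (hH.neg_mem (hsymm hax)) hxz)

theorem lcosetSetoid_add_left (hH : IsSubgyrogroup H)
    (hinv : ∀ a b : G, ∀ h ∈ H, gyr a b h ∈ H) (c a x : G)
    (h : lcosetSetoid hH hinv a x) : lcosetSetoid hH hinv (c + a) (c + x) := by
  change -(c + a) + (c + x) ∈ H
  rw [neg_add_add_left]
  exact hinv _ _ _ h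

end GyrInvariant

end Gyrogroup

/-- let `G` be a finite gyrogroup and `H` a subgyrogroup with
`[G : H] = p` the smallest prime dividing `|G|`. Then `H` is normal in `G` iff
there is `y ∉ H` with `gyr a b (iy ⊕ H) ⊆ iy ⊕ H` for all `a, b ∈ G` and
`i ∈ {0, 1, …, p-1}`. -/
theorem smallest_prime_index_normal_iff [Gyrogroup G] [Finite G] (H : Set G)
    (hH : IsSubgyrogroup H) (p : ℕ) (hp : p.Prime) (hidx : gyroIndex H = p)
    (hdvd : p ∣ Nat.card G)
    (hmin : ∀ q : ℕ, q.Prime → q ∣ Nat.card G → p ≤ q) :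
    IsNormalSubgyrogroup H ↔
      ∃ y : G, y ∉ H ∧ ∀ a b : G, ∀ i : ℕ, i ≤ p - 1 →
        ⇑(gyr a b) '' lcoset (gyroNsmul i y) H ⊆ lcoset (gyroNsmul i y) H := by
  subst hidx
  constructor
  · rintro ⟨-, A, instA, φ, hφ, rfl⟩
    have hs : ∀ a x, x ∈ lcoset a (gyroKer φ) ↔ Setoid.ker φ a x := fun a x =>
      mem_lcoset_gyroKer_iff hφ
    have hadd : ∀ a x z : G, Setoid.ker φ x z → Setoid.ker φ (a + x) (a + z) := by
      intro a x z h
      change φ (a + x) = φ (a + z)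
      rw [hφ, hφ, show φ x = φ z from h]
    obtain ⟨y, hy⟩ : ∃ y, y ∉ gyroKer φ := by
      by_contra! hall
      have hset : {S : Set G | ∃ a : G, S = lcoset a (gyroKer φ)} ⊆ {Set.univ} := by
        rintro S ⟨a, rfl⟩
        exact Set.eq_univ_of_forall fun x => mem_lcoset_iff.mpr (hall _)
      have hcard := Set.ncard_le_ncard hset
      rw [Set.ncard_singleton] at hcard
      exact absurd hp.one_lt hcard.not_gt
    refine ⟨y, hy, fun a b i _ => ?_⟩
    have hgen (x : G) : ∃ i, φ x = gyroNsmul i (φ y) := by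
      obtain ⟨i, -, hi⟩ := exists_gyroNsmul_rel hadd hs hmin hy x
      exact ⟨i, by rw [← map_gyroNsmul hφ]; exact hi.symm⟩
    rintro _ ⟨x, hx, rfl⟩
    rw [mem_lcoset_gyroKer_iff hφ] at hx ⊢
    obtain ⟨m, hm⟩ := hgen a
    obtain ⟨n, hn⟩ := hgen b
    rw [map_gyr hφ, hm, hn, gyr_gyroNsmul, hx]
  · rintro ⟨y, hy, hyinv⟩
    have hinv : ∀ a b : G, ∀ h ∈ H, gyr a b h ∈ H := by
      intro a b h hh
      have hzero : lcoset (gyroNsmul 0 y) H = H := by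
        ext x
        rw [mem_lcoset_iff, gyroNsmul, neg_zero', zero_add']
      have hsub := hyinv a b 0 (Nat.zero_le _)
      rw [hzero] at hsub
      exact hsub (Set.mem_image_of_mem _ hh)
    have hs : ∀ a x, x ∈ lcoset a H ↔ lcosetSetoid hH hinv a x := fun a x => mem_lcoset_iff
    have hadd := lcosetSetoid_add_left hH hinv
    refine isNormalSubgyrogroup_of_gyr_rel hadd hs hmin hH fun a b x => ?_
    obtain ⟨i, hi, hix⟩ := exists_gyroNsmul_rel hadd hs hmin hy x
    have hmem := hyinv a b i (Nat.le_sub_one_of_lt hi)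
      (Set.mem_image_of_mem _ ((hs _ _).mpr hix))
    exact Setoid.trans' _ (Setoid.symm' _ hix) ((hs _ _).mp hmem)
end
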